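/- Let q : ℝ → ℝ be measurable with ∫_a^∞ (1 + t²)·|q(t)| dt < ∞ for every a ∈ ℝ and set Q(x) = ∫_{x/2}^∞ |q(t)| dt. Let K : {(x,y) : y ≥ x} → ℝ be continuous with |K(x,y)| ≤ C(x)·Q(x+y) for some positive continuous nonincreasing C. Let F : ℝ² → ℝ be continuous and symmetric (F(x,y) = F(y,x)), bounded on {(x,y) : y ≥ x ≥ a} for every a ∈ ℝ, and satisfy the GLM equation K(x,y) + F(x,y) + ∫_x^∞ K(x,t)·F(t,y) dt = 0 for all y ≥ x. Then there exists a positive continuous nonincreasing function Ĉ : ℝ → ℝ with |F(x,y)| ≤ Ĉ(x)·Q(x+y) for all y ≥ x. -/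

import Mathlib

open MeasureTheory Filter

/-- `Q(x) = ∫_{x/2}^∞ |q(t)| dt`. -/
noncomputable def Qfun (q : ℝ → ℝ) (x : ℝ) : ℝ := ∫ t in Set.Ioi (x / 2), |q t|

section

open Set

/-- A fixed-point iteration for a weighted bound on a solution of the GLM equation. -/
theorem abs_le_of_weight {Q φ : ℝ → ℝ} {K F : ℝ → ℝ → ℝ} {a b B M : ℝ}
    (hQ0 : ∀ x, 0 ≤ Q x) (hQ : Antitone Q) (hB : 0 < B)
    (hK : ∀ x y, a ≤ x → x ≤ y → |K x y| ≤ B * Q (x + y))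
    (hsymm : ∀ x y, F x y = F y x)
    (hM : ∀ x y, a ≤ x → x ≤ y → |F x y| ≤ M)
    (hGLM : ∀ x y, x ≤ y → K x y + F x y + ∫ t in Ioi x, K x t * F t y = 0)
    (hφ : ∀ t, 1 ≤ φ t) (hφb : ∀ t, b ≤ t → φ t = 1)
    (hint : ∀ x, a ≤ x → IntegrableOn (fun t => Q (x + t) * φ t) (Ioi x))
    (hle : ∀ x, a ≤ x → B * ∫ t in Ioi x, Q (x + t) * φ t ≤ φ x / 2)
    {x y : ℝ} (hax : a ≤ x) (hxy : x ≤ y) (hby : b ≤ y) :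
    |F x y| ≤ 2 * B * φ x * Q (x + y) := by
  have hM0 : 0 ≤ M := (abs_nonneg _).trans (hM a a le_rfl le_rfl)
  have key : ∀ n : ℕ, ∀ x y, a ≤ x → x ≤ y → b ≤ y →
      |F x y| ≤ (2 * B * Q (x + y) + (1 / 2) ^ n * M) * φ x := by
    intro n
    induction n with
    | zero =>
      intro x y hax hxy _
      have h1 := hM x y hax hxy
      have h2 := mul_nonneg hB.le (hQ0 (x + y))
      nlinarith [hφ x]
    | succ n ih =>
      intro x y hax hxy hby
      set W := 2 * B * Q (x + y) + (1 / 2) ^ n * M with hW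
      have hW0 : 0 ≤ W := by have := hQ0 (x + y); positivity
      have hF : ∀ t, x ≤ t → |F t y| ≤ W * φ t := by
        intro t hxt
        have hmono : 2 * B * Q (t + y) + (1 / 2) ^ n * M ≤ W := by
          have : Q (t + y) ≤ Q (x + y) := hQ (by linarith)
          rw [hW]; gcongr
        have hφt := hφ t
        rcases le_total t y with hty | hty
        · exact (ih t y (hax.trans hxt) hty hby).trans (by gcongr)
        · have := ih y t (hax.trans hxy) hty (hby.trans hty)
          rw [hsymm, add_comm y t, hφb y hby] at this
          rw [hφb t (hby.trans hty)]
          linarith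
      have hI : |∫ t in Ioi x, K x t * F t y| ≤
          ∫ t in Ioi x, (B * W) * (Q (x + t) * φ t) := by
        rw [← Real.norm_eq_abs]
        refine norm_integral_le_of_norm_le ((hint x hax).const_mul _) ?_
        refine (ae_restrict_iff' measurableSet_Ioi).2 (ae_of_all _ fun t ht => ?_)
        have ht' : x ≤ t := le_of_lt ht
        rw [Real.norm_eq_abs, abs_mul]
        calc |K x t| * |F t y| ≤ (B * Q (x + t)) * (W * φ t) :=
              mul_le_mul (hK x t hax ht') (hF t ht') (abs_nonneg _)
                (mul_nonneg hB.le (hQ0 _))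
          _ = _ := by ring
      rw [integral_const_mul] at hI
      have h1 := hGLM x y hxy
      have h2 := hK x y hax hxy
      have h3 := mul_le_mul_of_nonneg_left (hle x hax) hW0
      have h4 : |F x y| ≤ |K x y| + |∫ t in Ioi x, K x t * F t y| := by
        rw [show F x y = -(K x y + ∫ t in Ioi x, K x t * F t y) by linarith, abs_neg]
        exact abs_add_le _ _
      have h5 : B * Q (x + y) ≤ B * Q (x + y) * φ x :=
        le_mul_of_one_le_right (mul_nonneg hB.le (hQ0 _)) (hφ x)
      rw [pow_succ]
      have h6 : W * φ x / 2 = (B * Q (x + y) + (1 / 2) ^ n * M / 2) * φ x := by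
        rw [hW]; ring
      nlinarith
  have hlim : Tendsto (fun n : ℕ => (2 * B * Q (x + y) + (1 / 2) ^ n * M) * φ x) atTop
      (nhds ((2 * B * Q (x + y) + 0 * M) * φ x)) :=
    (((tendsto_pow_atTop_nhds_zero_of_lt_one (by norm_num) (by norm_num)).mul_const M).const_add
      _).mul_const _
  have := ge_of_tendsto' hlim fun n => key n x y hax hxy hby
  linarith

/-- An antitone function is dominated by a continuous antitone function. -/
theorem Antitone.exists_continuous_ge {d : ℝ → ℝ} (hd : Antitone d) :
    ∃ g : ℝ → ℝ, Continuous g ∧ Antitone g ∧ ∀ x, d x ≤ g x := by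
  have hi : ∀ u v, IntervalIntegrable d volume u v := fun u v => hd.intervalIntegrable
  have hi' : ∀ x, IntervalIntegrable (fun s => d (s + (x - 1))) volume 0 1 := fun x =>
    Antitone.intervalIntegrable fun s t hst => hd (by linarith)
  have heq : ∀ x, ∫ s in (0 : ℝ)..1, d (s + (x - 1)) = ∫ s in (x - 1)..x, d s := fun x => by
    rw [intervalIntegral.integral_comp_add_right]; congr 1 <;> ring
  refine ⟨fun x => ∫ s in (x - 1)..x, d s, ?_, ?_, ?_⟩
  · have hc := intervalIntegral.continuous_primitive hi 0
    have : (fun x => ∫ s in (x - 1)..x, d s) =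
        fun x => (∫ s in (0 : ℝ)..x, d s) - ∫ s in (0 : ℝ)..(x - 1), d s := by
      ext x
      rw [intervalIntegral.integral_interval_sub_left (hi _ _) (hi _ _)]
    rw [this]
    exact hc.sub (hc.comp (continuous_id.sub continuous_const))
  · intro x y hxy
    simp only [← heq]
    exact intervalIntegral.integral_mono_on zero_le_one (hi' y) (hi' x)
      fun s _ => hd (by linarith)
  · intro x
    have := intervalIntegral.integral_mono_on (zero_le_one) (intervalIntegrable_const (c := d x))
      (hi' x) fun s hs => hd (by linarith [hs.2])
    rw [heq] at this
    simpa using this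

theorem Qfun_nonneg (q : ℝ → ℝ) (x : ℝ) : 0 ≤ Qfun q x :=
  integral_nonneg fun _ => abs_nonneg _

theorem integrableOn_abs_of_moment {q : ℝ → ℝ} (hq : Measurable q)
    (hmom : ∀ a : ℝ, IntegrableOn (fun t => (1 + t ^ 2) * |q t|) (Ioi a)) (a : ℝ) :
    IntegrableOn (fun t => |q t|) (Ioi a) := by
  refine (hmom a).mono' hq.abs.aestronglyMeasurable (ae_of_all _ fun t => ?_)
  rw [Real.norm_eq_abs, abs_abs]
  nlinarith [abs_nonneg (q t), sq_nonneg t]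

theorem Qfun_antitone {q : ℝ → ℝ} (hq : ∀ a : ℝ, IntegrableOn (fun t => |q t|) (Ioi a)) :
    Antitone (Qfun q) := fun x y hxy =>
  setIntegral_mono_set (hq _) (ae_of_all _ fun _ => abs_nonneg _)
    (Ioi_subset_Ioi (by linarith)).eventuallyLE

theorem Qfun_integrableOn {q : ℝ → ℝ} (hq : Measurable q)
    (hmom : ∀ a : ℝ, IntegrableOn (fun t => (1 + t ^ 2) * |q t|) (Ioi a)) (a : ℝ) :
    IntegrableOn (Qfun q) (Ioi a) := by
  have hanti := Qfun_antitone (integrableOn_abs_of_moment hq hmom)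
  have h0 : IntegrableOn (Qfun q) (Ioi 0) := by
    set m := ∫ t in Ioi (0 : ℝ), (1 + t ^ 2) * |q t|
    refine ((integrable_inv_one_add_sq.const_mul (4 * m)).integrableOn).mono'
      hanti.measurable.aestronglyMeasurable
      ((ae_restrict_iff' measurableSet_Ioi).2 (ae_of_all _ fun x hx => ?_))
    have hx : 0 < x := hx
    rw [Real.norm_of_nonneg (Qfun_nonneg q x), ← div_eq_mul_inv, le_div_iff₀ (by positivity)]
    have h1 : (1 + (x / 2) ^ 2) * Qfun q x ≤ ∫ t in Ioi (x / 2), (1 + t ^ 2) * |q t| := by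
      rw [Qfun, ← integral_const_mul]
      refine setIntegral_mono_on ((integrableOn_abs_of_moment hq hmom _).const_mul _) (hmom _)
        measurableSet_Ioi fun t ht => ?_
      have ht : x / 2 < t := ht
      have : (x / 2) ^ 2 ≤ t ^ 2 := by gcongr
      gcongr
    have h2 : ∫ t in Ioi (x / 2), (1 + t ^ 2) * |q t| ≤ m :=
      setIntegral_mono_set (hmom _) (ae_of_all _ fun t => by positivity)
        (Ioi_subset_Ioi (by linarith)).eventuallyLE
    nlinarith [Qfun_nonneg q x]
  have h1 : IntegrableOn (Qfun q) (Icc a 0) :=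
    (hanti.antitoneOn _).integrableOn_isCompact isCompact_Icc
  refine (h1.union h0).mono_set fun t ht => ?_
  rcases le_or_gt t 0 with h | h
  · exact Or.inl ⟨le_of_lt ht, h⟩
  · exact Or.inr h

theorem integrableOn_comp_add_left_Ioi {f : ℝ → ℝ} {x b : ℝ}
    (hf : IntegrableOn f (Ioi (x + b))) : IntegrableOn (fun t => f (x + t)) (Ioi b) := by
  have := ((measurePreserving_add_left volume x).integrableOn_comp_preimage
    (measurableEmbedding_addLeft x) (f := f) (s := Ioi (x + b))).2 hf
  simpa [Function.comp_def] using this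

theorem setIntegral_comp_add_left_Ioi (f : ℝ → ℝ) (x b : ℝ) :
    ∫ t in Ioi b, f (x + t) = ∫ t in Ioi (x + b), f t := by
  have := (measurePreserving_add_left volume x).setIntegral_preimage_emb
    (measurableEmbedding_addLeft x) f (Ioi (x + b))
  simpa using this

theorem exists_setIntegral_Ioi_le {Q : ℝ → ℝ} {a δ : ℝ} (hQ0 : ∀ x, 0 ≤ Q x) (hQ : Antitone Q)
    (hint : IntegrableOn Q (Ioi a)) (hδ : 0 < δ) :
    ∃ s, a ≤ s ∧ (s = a ∨ 0 < Q s) ∧ ∫ t in Ioi s, Q t ≤ δ := by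
  rcases le_or_gt (∫ t in Ioi a, Q t) δ with h | h
  · exact ⟨a, le_rfl, Or.inl rfl, h⟩
  have hii : ∀ u v, IntervalIntegrable Q volume u v := fun u v => hQ.intervalIntegrable
  have hlim : Tendsto (fun r => ∫ t in a..r, Q t) atTop (nhds (∫ t in Ioi a, Q t)) :=
    intervalIntegral_tendsto_integral_Ioi a hint tendsto_id
  obtain ⟨r, hr, har⟩ := ((hlim.eventually_const_lt
    (show (∫ t in Ioi a, Q t) - δ < ∫ t in Ioi a, Q t by linarith)).and
    (eventually_ge_atTop a)).exists
  obtain ⟨s, hs, hsδ⟩ := intermediate_value_Icc har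
    (intervalIntegral.continuous_primitive hii a).continuousOn
    (show (∫ t in Ioi a, Q t) - δ ∈ Icc _ _ from ⟨by simpa using h.le, hr.le⟩)
  have hsplit : ∫ t in Ioi s, Q t = δ := by
    have := intervalIntegral.integral_Ioi_sub_Ioi hint hs.1
    simp only at hsδ
    linarith
  refine ⟨s, hs.1, Or.inr ((hQ0 s).lt_of_ne fun h0 => hδ.ne ?_), hsplit.le⟩
  rw [← hsplit]
  refine (setIntegral_eq_zero_of_forall_eq_zero fun t ht => ?_).symm
  exact le_antisymm (h0 ▸ hQ (le_of_lt ht)) (hQ0 t)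

theorem intervalIntegral_exp_mul_sub {l : ℝ} (hl : l ≠ 0) (x b : ℝ) :
    ∫ t in x..b, Real.exp (l * (b - t)) = (Real.exp (l * (b - x)) - 1) / l := by
  have hd : ∀ t ∈ uIcc x b, HasDerivAt (fun t => -Real.exp (l * (b - t)) / l)
      (Real.exp (l * (b - t))) t := by
    intro t _
    have := ((((hasDerivAt_id t).const_sub b).const_mul l).exp.neg.div_const l)
    refine this.congr_deriv ?_
    rw [div_eq_iff hl]
    simp
  rw [intervalIntegral.integral_eq_sub_of_hasDerivAt hd
    (Continuous.intervalIntegrable (by fun_prop) _ _)]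
  simp
  ring

/-- A weight that equals `1` beyond `b` and makes the operator with kernel `Q (x + t)` a
contraction on `[a, ∞)`. -/
theorem exists_contraction_weight {Q : ℝ → ℝ} {a b B : ℝ} (hQ0 : ∀ x, 0 ≤ Q x) (hQ : Antitone Q)
    (hint : ∀ a, IntegrableOn Q (Ioi a)) (hB : 0 < B)
    (hb : B * ∫ t in Ioi (2 * b), Q t ≤ 1 / 2) :
    ∃ φ : ℝ → ℝ, Antitone φ ∧ (∀ t, 1 ≤ φ t) ∧ (∀ t, b ≤ t → φ t = 1) ∧
      (∀ x, a ≤ x → IntegrableOn (fun t => Q (x + t) * φ t) (Ioi x)) ∧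
      ∀ x, a ≤ x → B * ∫ t in Ioi x, Q (x + t) * φ t ≤ φ x / 2 := by
  set H : ℝ → ℝ := fun s => ∫ t in Ioi s, Q t with hH
  have hH0 : ∀ s, 0 ≤ H s := fun s => integral_nonneg fun _ => hQ0 _
  have hHanti : Antitone H := fun s r hsr => setIntegral_mono_set (hint s)
    (ae_of_all _ fun _ => hQ0 _) (Ioi_subset_Ioi hsr).eventuallyLE
  set A := 4 * B * H (a + b) + 1 with hA
  set l := 4 * B * Q (2 * a) + 1 with hl
  have hA1 : 1 ≤ A := by have := mul_nonneg hB.le (hH0 (a + b)); linarith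
  have hl1 : 1 ≤ l := by have := mul_nonneg hB.le (hQ0 (2 * a)); linarith
  set φ : ℝ → ℝ := fun t => if t < b then A * Real.exp (l * (b - t)) else 1 with hφ
  have hexp : ∀ t, t ≤ b → 1 ≤ Real.exp (l * (b - t)) := fun t ht =>
    Real.one_le_exp (mul_nonneg (by linarith) (by linarith))
  have hφlt : ∀ t, t < b → φ t = A * Real.exp (l * (b - t)) := fun t ht => if_pos ht
  have hφge : ∀ t, b ≤ t → φ t = 1 := fun t ht => if_neg ht.not_gt
  have hφ1 : ∀ t, 1 ≤ φ t := by
    intro t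
    rcases lt_or_ge t b with h | h
    · rw [hφlt t h]; nlinarith [hexp t h.le]
    · rw [hφge t h]
  have hφanti : Antitone φ := by
    intro s t hst
    rcases lt_or_ge t b with h | h
    · rw [hφlt t h, hφlt s (hst.trans_lt h)]
      gcongr
    · rw [hφge t h]; exact hφ1 s
  have hφle : ∀ t, t ≤ b → φ t ≤ A * Real.exp (l * (b - t)) := by
    intro t ht
    rcases ht.lt_or_eq with h | rfl
    · rw [hφlt t h]
    · rw [hφge t le_rfl]; nlinarith [hexp t le_rfl]
  have hI : ∀ x u, x ≤ u → IntegrableOn (fun t => Q (x + t) * φ t) (Ioi u) := by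
    intro x u hxu
    refine (integrableOn_comp_add_left_Ioi (hint _)).mul_bdd (c := φ x)
      hφanti.measurable.aestronglyMeasurable
      ((ae_restrict_iff' measurableSet_Ioi).2 (ae_of_all _ fun t ht => ?_))
    rw [Real.norm_of_nonneg (zero_le_one.trans (hφ1 t))]
    exact hφanti (hxu.trans (le_of_lt ht))
  have htail : ∀ x u, b ≤ u → ∫ t in Ioi u, Q (x + t) * φ t = H (x + u) := by
    intro x u hu
    simp only [hH]
    rw [← setIntegral_comp_add_left_Ioi]
    refine setIntegral_congr_fun measurableSet_Ioi fun t ht => ?_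
    simp only [hφge t (hu.trans (le_of_lt ht)), mul_one]
  refine ⟨φ, hφanti, hφ1, hφge, fun x _ => hI x x le_rfl, fun x hax => ?_⟩
  rcases lt_or_ge x b with h | h
  · rw [← intervalIntegral.integral_interval_add_Ioi (hI x x le_rfl) (hI x b h.le),
      htail x b le_rfl]
    have h1 : ∫ t in x..b, Q (x + t) * φ t ≤
        ∫ t in x..b, (Q (2 * a) * A) * Real.exp (l * (b - t)) := by
      refine intervalIntegral.integral_mono_on h.le ?_
        (Continuous.intervalIntegrable (by fun_prop) _ _) fun t ht => ?_
      · exact (intervalIntegrable_iff_integrableOn_Ioc_of_le h.le).2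
          ((hI x x le_rfl).mono_set Ioc_subset_Ioi_self)
      · rw [mul_assoc]
        exact mul_le_mul (hQ (by linarith [ht.1])) (hφle t ht.2)
          (zero_le_one.trans (hφ1 t)) (hQ0 _)
    rw [intervalIntegral.integral_const_mul,
      intervalIntegral_exp_mul_sub (by linarith)] at h1
    have h2 : H (x + b) ≤ H (a + b) := hHanti (by linarith)
    rw [hφlt x h]
    set E := Real.exp (l * (b - x))
    have hE : 1 ≤ E := hexp x h.le
    have h3 : B * (Q (2 * a) * A * ((E - 1) / l)) ≤ A * E / 4 := by
      have : B * (Q (2 * a) * A * ((E - 1) / l)) = (B * Q (2 * a)) * (A * (E - 1)) / l := by ring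
      rw [this, div_le_iff₀ (by linarith)]
      have h4 : B * Q (2 * a) ≤ l / 4 := by linarith
      have h5 : A * (E - 1) ≤ A * E := by linarith
      calc B * Q (2 * a) * (A * (E - 1)) ≤ l / 4 * (A * E) :=
            mul_le_mul h4 h5 (mul_nonneg (by linarith) (by linarith)) (by linarith)
        _ = _ := by ring
    have h6 : B * H (x + b) ≤ A / 4 := by
      have := mul_le_mul_of_nonneg_left h2 hB.le
      linarith
    have h7 : A ≤ A * E := le_mul_of_one_le_right (by linarith) hE
    have := mul_le_mul_of_nonneg_left h1 hB.le
    rw [mul_add]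
    linarith
  · rw [htail x x h, hφge x h]
    have := mul_le_mul_of_nonneg_left (hHanti (show 2 * b ≤ x + x by linarith)) hB.le
    exact this.trans hb

/-- A bounded symmetric solution of the GLM equation obeys the kernel estimate, uniformly on
`a ≤ x ≤ y`. -/
theorem exists_bound_of_glm {Q : ℝ → ℝ} {K F : ℝ → ℝ → ℝ} {a B M : ℝ}
    (hQ0 : ∀ x, 0 ≤ Q x) (hQ : Antitone Q) (hint : ∀ a, IntegrableOn Q (Ioi a)) (hB : 0 < B)
    (hK : ∀ x y, a ≤ x → x ≤ y → |K x y| ≤ B * Q (x + y))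
    (hsymm : ∀ x y, F x y = F y x)
    (hM : ∀ x y, a ≤ x → x ≤ y → |F x y| ≤ M)
    (hGLM : ∀ x y, x ≤ y → K x y + F x y + ∫ t in Ioi x, K x t * F t y = 0) :
    ∃ D, 0 ≤ D ∧ ∀ x y, a ≤ x → x ≤ y → |F x y| ≤ D * Q (x + y) := by
  obtain ⟨s, has, hs, hsB⟩ := exists_setIntegral_Ioi_le (δ := 1 / (2 * B)) hQ0 hQ
    (hint (2 * a)) (by positivity)
  obtain ⟨b, rfl⟩ : ∃ b, s = 2 * b := ⟨s / 2, by ring⟩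
  have hbB : B * ∫ t in Ioi (2 * b), Q t ≤ 1 / 2 := by
    calc _ ≤ B * (1 / (2 * B)) := by gcongr
      _ = 1 / 2 := by field_simp
  obtain ⟨φ, hφanti, hφ1, hφb, hφi, hφle⟩ :=
    exists_contraction_weight (a := a) hQ0 hQ hint hB hbB
  have hM0 : 0 ≤ M := (abs_nonneg _).trans (hM a a le_rfl le_rfl)
  have hφa := hφ1 a
  have hd1 : 0 ≤ 2 * B * φ a := by positivity
  have hd2 : 0 ≤ M / Q (2 * b) := div_nonneg hM0 (hQ0 _)
  refine ⟨2 * B * φ a + M / Q (2 * b), by linarith, fun x y hax hxy => ?_⟩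
  rcases le_or_gt b y with hby | hyb
  · refine (abs_le_of_weight hQ0 hQ hB hK hsymm hM hGLM hφ1 hφb hφi hφle hax hxy hby).trans ?_
    refine mul_le_mul_of_nonneg_right ?_ (hQ0 _)
    have := mul_le_mul_of_nonneg_left (hφanti hax) (by positivity : 0 ≤ 2 * B)
    linarith
  · have hpos : 0 < Q (2 * b) := hs.resolve_left fun h => by linarith
    calc |F x y| ≤ M := hM x y hax hxy
      _ = M / Q (2 * b) * Q (2 * b) := by field_simp
      _ ≤ _ := mul_le_mul (by linarith) (hQ (by linarith)) (hQ0 _) (by linarith)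

end

/-- Estimate (A.29) of Lemma A.3: if `K` satisfies `|K(x,y)| ≤ C(x)·Q(x+y)` and `F`
is a bounded symmetric continuous solution of the GLM equation, then
`|F(x,y)| ≤ Ĉ(x)·Q(x+y)` for some positive continuous nonincreasing `Ĉ`. -/
theorem glm_kernel_estimate
    (q : ℝ → ℝ) (hq : Measurable q)
    (hmom : ∀ a : ℝ, IntegrableOn (fun t => (1 + t ^ 2) * |q t|) (Set.Ioi a))
    (K : ℝ → ℝ → ℝ)
    (hKcont : ContinuousOn (fun p : ℝ × ℝ => K p.1 p.2) {p : ℝ × ℝ | p.1 ≤ p.2})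
    (C : ℝ → ℝ) (hC : Continuous C) (hCpos : ∀ x, 0 < C x) (hCanti : Antitone C)
    (hKbd : ∀ x y : ℝ, x ≤ y → |K x y| ≤ C x * Qfun q (x + y))
    (F : ℝ → ℝ → ℝ)
    (hFcont : Continuous fun p : ℝ × ℝ => F p.1 p.2)
    (hFsymm : ∀ x y : ℝ, F x y = F y x)
    (hFbd : ∀ a : ℝ, ∃ M : ℝ, ∀ x y : ℝ, a ≤ x → x ≤ y → |F x y| ≤ M)
    (hGLM : ∀ x y : ℝ, x ≤ y →
      K x y + F x y + ∫ t in Set.Ioi x, K x t * F t y = 0) :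
    ∃ Chat : ℝ → ℝ, Continuous Chat ∧ (∀ x, 0 < Chat x) ∧ Antitone Chat ∧
      ∀ x y : ℝ, x ≤ y → |F x y| ≤ Chat x * Qfun q (x + y) := by
  have hQ0 := Qfun_nonneg q
  have hD : ∀ a : ℝ, ∃ D, 0 ≤ D ∧ ∀ x y, a ≤ x → x ≤ y → |F x y| ≤ D * Qfun q (x + y) := by
    intro a
    obtain ⟨M, hM⟩ := hFbd a
    refine exists_bound_of_glm (K := K) hQ0
      (Qfun_antitone (integrableOn_abs_of_moment hq hmom)) (Qfun_integrableOn hq hmom) (hCpos a)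
      (fun x y hax hxy => (hKbd x y hxy).trans ?_) hFsymm hM hGLM
    exact mul_le_mul_of_nonneg_right (hCanti hax) (hQ0 _)
  set S : ℝ → Set ℝ := fun a =>
    {D | 0 ≤ D ∧ ∀ x y, a ≤ x → x ≤ y → |F x y| ≤ D * Qfun q (x + y)} with hS
  have hSne : ∀ a, (S a).Nonempty := hD
  have hSbdd : ∀ a, BddBelow (S a) := fun a => ⟨0, fun D hD => hD.1⟩
  have hSanti : Antitone fun a => sInf (S a) := fun a a' haa' =>
    csInf_le_csInf (hSbdd a') (hSne a) fun D hD =>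
      ⟨hD.1, fun x y hx hxy => hD.2 x y (haa'.trans hx) hxy⟩
  have hSmem : ∀ x y, x ≤ y → |F x y| ≤ sInf (S x) * Qfun q (x + y) := by
    intro x y hxy
    rcases (hQ0 (x + y)).eq_or_lt with h0 | hpos
    · obtain ⟨D, -, hD⟩ := hSne x
      simpa [← h0] using hD x y le_rfl hxy
    · rw [← div_le_iff₀ hpos]
      exact le_csInf (hSne x) fun D hD => (div_le_iff₀ hpos).2 (hD.2 x y le_rfl hxy)
  obtain ⟨g, hgc, hganti, hg⟩ := hSanti.exists_continuous_ge
  have hg0 : ∀ x, 0 ≤ g x := fun x => (Real.sInf_nonneg fun D hD => hD.1).trans (hg x)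
  refine ⟨fun x => g x + 1, hgc.add continuous_const, fun x => by linarith [hg0 x],
    hganti.add_const 1, fun x y hxy => (hSmem x y hxy).trans ?_⟩
  exact mul_le_mul_of_nonneg_right (by linarith [hg x]) (hQ0 _)
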